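/- Well-definedness of tree stacking and the trunk index formula: for P ∈ 𝒜(n;r), Q ∈ 𝒜(m;s) and k ∈ {1,…,n}, the stacked diagram P ≺_k Q is a planar tree diagram in 𝒜(m+n−1;t), where t = r if r < k, t = r + m − 1 if r > k, and t = r + s − 1 if r = k. -/

import Mathlib

open scoped BigOperators

/-!  Combinatorial framework for Gauss diagrams of (string) links and for the
Kravchenko–Polyak tree diagrams/tree invariants (following the paper
"Tree invariants and Milnor linking numbers with indeterminacy").

Strings of a diagram on `n` strings are indexed by `1, …, n`; each string is
oriented downward from a basepoint at its top, and the position of an endpoint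
on its string is a rational number which increases from top to bottom. -/

/-- A Gauss diagram on `n` strings: a finite type of signed arrows, each with a
head endpoint and a tail endpoint lying on strings `1,…,n`, all endpoints
distinct, the endpoints on each string being linearly ordered (top-to-bottom)
by their position. An endpoint is encoded as a pair `(g, b)` where `b = true`
designates the head of the arrow `g` and `b = false` its tail. -/
structure GaussDiagram (n : ℕ) where
  Arrow : Type
  fin : Fintype Arrow
  dec : DecidableEq Arrow
  /-- the string carrying the head of an arrow -/
  hs : Arrow → ℕ
  /-- the string carrying the tail of an arrow -/
  ts : Arrow → ℕ
  /-- the position of the head on its string (positions increase downward) -/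
  hp : Arrow → ℚ
  /-- the position of the tail on its string -/
  tp : Arrow → ℚ
  /-- the sign `ε(g) ∈ {+1, -1}` of an arrow -/
  sign : Arrow → ℤ
  hs_mem : ∀ g, hs g ∈ Finset.Icc 1 n
  ts_mem : ∀ g, ts g ∈ Finset.Icc 1 n
  sign_unit : ∀ g, sign g = 1 ∨ sign g = -1
  /-- all endpoints are distinct -/
  distinct : ∀ e e' : Arrow × Bool,
    (if e.2 then hs e.1 else ts e.1) = (if e'.2 then hs e'.1 else ts e'.1) →
    (if e.2 then hp e.1 else tp e.1) = (if e'.2 then hp e'.1 else tp e'.1) →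
    e = e'

attribute [instance] GaussDiagram.fin GaussDiagram.dec

namespace GaussDiagram

variable {n : ℕ}

/-- the string on which an endpoint lies -/
def estr (G : GaussDiagram n) (e : G.Arrow × Bool) : ℕ :=
  if e.2 then G.hs e.1 else G.ts e.1

/-- the position of an endpoint on its string -/
def epos (G : GaussDiagram n) (e : G.Arrow × Bool) : ℚ :=
  if e.2 then G.hp e.1 else G.tp e.1

end GaussDiagram

/-- The data of a tree diagram.  By axiom (d2), a tree diagram with leaves
indexed by `I` and trunk `j` has exactly one arrow tailed at each string
`i ∈ I \ {j}`, so its arrows are canonically indexed by `I.erase j`: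
`par i` is the string carrying the head of the arrow tailed at string `i`
(the "parent" string), and `rk i` is the rank (counted from the top, starting
at `0`) of the head of this arrow among all the arrowheads lying on the string
`par i`.  By axiom (d4) the tail on a string lies below all the heads on that
string, so `par` and `rk` determine the diagram up to isomorphism.  Junk
values are pinned by `par i = i` and `rk i = 0` outside `I.erase j`. -/
structure PreTree where
  par : ℕ → ℕ
  rk : ℕ → ℕ

namespace PreTree

/-- `A` is a tree diagram with leaves indexed by `I` and trunk `j`:
axioms (d1)–(d4), together with canonicality of the ranks and the pinning of
junk values. -/
def IsTreeDiagram (I : Finset ℕ) (j : ℕ) (A : PreTree) : Prop :=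
  (∀ i ∈ I.erase j, A.par i ∈ I ∧ A.par i ≠ i ∧
      A.rk i < (((I.erase j).filter fun b => A.par b = A.par i)).card) ∧
  (∀ i ∈ I.erase j, ∀ i' ∈ I.erase j,
      A.par i = A.par i' → A.rk i = A.rk i' → i = i') ∧
  (∀ i, i ∉ I.erase j → A.par i = i ∧ A.rk i = 0)

/-- `A` is planar: the associated rooted tree admits a planar embedding in
which the strings appear in increasing left-to-right order.  Concretely, the
arrows can be drawn as horizontal segments at pairwise distinct heights
`h i` (heights increase downward), compatibly with the order of the endpoints
on each string, in such a way that no arrow crosses the retained part of an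
intermediate string (in particular no arrow passes over the trunk). -/
def IsPlanar (I : Finset ℕ) (j : ℕ) (A : PreTree) : Prop :=
  ∃ h : ℕ → ℚ,
    (∀ i ∈ I.erase j, ∀ i' ∈ I.erase j, h i = h i' → i = i') ∧
    (∀ i ∈ I.erase j, ∀ i' ∈ I.erase j, A.par i = A.par i' →
        (A.rk i < A.rk i' ↔ h i < h i')) ∧
    (∀ i ∈ I.erase j, ∀ i' ∈ I.erase j, A.par i = i' → h i < h i') ∧
    (∀ a ∈ I.erase j, ∀ k ∈ I, min (A.par a) a < k → k < max (A.par a) a →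
        k ≠ j ∧ h k < h a)

end PreTree

/-- `𝒜(I;j)`: the set of planar tree diagrams with leaves indexed by `I` and
trunk `j`. -/
def TreeSet (I : Finset ℕ) (j : ℕ) : Set PreTree :=
  {A | A.IsTreeDiagram I j ∧ A.IsPlanar I j}

/-- `𝒜(n;r) = 𝒜({1,…,n};r)`. -/
def TreeSetFull (n r : ℕ) : Set PreTree :=
  TreeSet (Finset.Icc 1 n) r

/-- `sign(A) = (-1)^q` where `q` is the number of arrows of `A` pointing to
the right, i.e. whose head lies on a higher-indexed string than the tail. -/
def treeSign (I : Finset ℕ) (j : ℕ) (A : PreTree) : ℤ :=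
  (-1) ^ (((I.erase j).filter fun i => i < A.par i)).card

/-- A representation `φ` of the tree diagram `A` (with leaves `I`, trunk `j`)
in the Gauss diagram `G`: an injective map from the arrows of `A` (indexed by
their tail strings) to the arrows of `G`, preserving head strings, tail
strings, and the top-to-bottom order of the endpoints on each string. -/
def IsRep {n : ℕ} (G : GaussDiagram n) (I : Finset ℕ) (j : ℕ) (A : PreTree)
    (φ : {x // x ∈ I.erase j} → G.Arrow) : Prop :=
  Function.Injective φ ∧
  (∀ a, G.hs (φ a) = A.par a.1) ∧
  (∀ a, G.ts (φ a) = a.1) ∧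
  (∀ a a', A.par a.1 = A.par a'.1 →
      (A.rk a.1 < A.rk a'.1 ↔ G.hp (φ a) < G.hp (φ a'))) ∧
  (∀ a a', A.par a.1 = a'.1 → G.hp (φ a) < G.tp (φ a'))

/-- `sign(φ) = ∏_{α ∈ A} ε(φ(α))`. -/
noncomputable def repSign {n : ℕ} (G : GaussDiagram n) {s : Finset ℕ}
    (φ : {x // x ∈ s} → G.Arrow) : ℤ :=
  ∏ᶠ a, G.sign (φ a)

/-- `⟨A,G⟩ = ∑_φ sign(φ)`, the sum over all representations of `A` in `G`. -/
noncomputable def pair {n : ℕ} (G : GaussDiagram n) (I : Finset ℕ) (j : ℕ)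
    (A : PreTree) : ℤ :=
  ∑ᶠ (φ : {x // x ∈ I.erase j} → G.Arrow) (_ : IsRep G I j A φ), repSign G φ

/-- `⟨A,G⟩_{α ↦ g}`: the part of `⟨A,G⟩` coming from representations sending
the arrow `α` of `A` tailed at the string `a` to the arrow `g` of `G`. -/
noncomputable def pairTo {n : ℕ} (G : GaussDiagram n) (I : Finset ℕ) (j : ℕ)
    (A : PreTree) (a : {x // x ∈ I.erase j}) (g : G.Arrow) : ℤ :=
  ∑ᶠ (φ : {x // x ∈ I.erase j} → G.Arrow) (_ : IsRep G I j A φ ∧ φ a = g),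
    repSign G φ

/-- `⟨A,G⟩_{α ↛ g}`: the part of `⟨A,G⟩` coming from representations not
sending the arrow `α` of `A` tailed at the string `a` to the arrow `g`. -/
noncomputable def pairNotTo {n : ℕ} (G : GaussDiagram n) (I : Finset ℕ) (j : ℕ)
    (A : PreTree) (a : {x // x ∈ I.erase j}) (g : G.Arrow) : ℤ :=
  ∑ᶠ (φ : {x // x ∈ I.erase j} → G.Arrow) (_ : IsRep G I j A φ ∧ φ a ≠ g),
    repSign G φ

/-- The tree pairing `⟨Z_{I;j},G⟩ = ∑_{A ∈ 𝒜(I;j)} sign(A)⟨A,G⟩`. -/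
noncomputable def Zpair {n : ℕ} (G : GaussDiagram n) (I : Finset ℕ) (j : ℕ) : ℤ :=
  ∑ᶠ (A : PreTree) (_ : A ∈ TreeSet I j), treeSign I j A * pair G I j A

/-- `Δ_Z(I;·) = gcd{⟨Z_{J;k},G⟩ : J ⊊ I, k ∈ J}`. -/
noncomputable def DeltaZ {n : ℕ} (G : GaussDiagram n) (I : Finset ℕ) : ℤ :=
  (((I.powerset.erase I).sigma fun J => J)).gcd fun p => Zpair G p.1 p.2
/-! ### Moves on Gauss diagrams -/

/-- The endpoints `e₁` and `e₂` (lying on a common string) are consecutive on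
their string: no other endpoint lies strictly between them. -/
def Consecutive {n : ℕ} (G : GaussDiagram n) (e₁ e₂ : G.Arrow × Bool) : Prop :=
  ∀ e : G.Arrow × Bool, e ≠ e₁ → e ≠ e₂ → G.estr e = G.estr e₁ →
    ¬ (min (G.epos e₁) (G.epos e₂) < G.epos e ∧
        G.epos e < max (G.epos e₁) (G.epos e₂))

/-- `ψ` matches arrows of `G` with arrows of `G'` preserving signs, head
strings and tail strings. -/
def ArrowMap {n : ℕ} (G G' : GaussDiagram n) (ψ : G.Arrow → G'.Arrow) : Prop :=
  (∀ g, G'.sign (ψ g) = G.sign g) ∧ (∀ g, G'.hs (ψ g) = G.hs g) ∧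
  (∀ g, G'.ts (ψ g) = G.ts g)

/-- `ψ` preserves the relative (top-to-bottom) order of all pairs of endpoints
lying on a common string, except possibly for pairs meeting the set `S`. -/
def OrderPresOn {n : ℕ} (G G' : GaussDiagram n) (ψ : G.Arrow → G'.Arrow)
    (S : Set (G.Arrow × Bool)) : Prop :=
  ∀ e e' : G.Arrow × Bool, e ∉ S → e' ∉ S → G.estr e = G.estr e' →
    (G.epos e < G.epos e' ↔ G'.epos (ψ e.1, e.2) < G'.epos (ψ e'.1, e'.2))

/-- Basepoint move: on one string, the topmost endpoint becomes the bottommost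
endpoint of that string (or vice versa); all other data are unchanged. -/
def BasepointMove {n : ℕ} (G G' : GaussDiagram n) : Prop :=
  ∃ ψ : G.Arrow ≃ G'.Arrow, ArrowMap G G' ψ ∧
    ∃ e₀ : G.Arrow × Bool,
      OrderPresOn G G' ψ {e₀} ∧
      ((∀ e, e ≠ e₀ → G.estr e = G.estr e₀ →
          G.epos e₀ < G.epos e ∧ G'.epos (ψ e.1, e.2) < G'.epos (ψ e₀.1, e₀.2)) ∨
       (∀ e, e ≠ e₀ → G.estr e = G.estr e₀ →
          G.epos e < G.epos e₀ ∧ G'.epos (ψ e₀.1, e₀.2) < G'.epos (ψ e.1, e.2)))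

/-- Insertion of an isolated arrow `g₀` whose head and tail are consecutive
endpoints on a single string (first Reidemeister move). -/
def R1Ins {n : ℕ} (G G' : GaussDiagram n) : Prop :=
  ∃ (ψ : G.Arrow → G'.Arrow) (g₀ : G'.Arrow),
    Function.Injective ψ ∧ ArrowMap G G' ψ ∧ OrderPresOn G G' ψ ∅ ∧
    (∀ g, ψ g ≠ g₀) ∧ (∀ h, h ≠ g₀ → ∃ g, ψ g = h) ∧
    G'.hs g₀ = G'.ts g₀ ∧ Consecutive G' (g₀, true) (g₀, false)

/-- First Reidemeister move (insertion or deletion). -/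
def R1Move {n : ℕ} (G G' : GaussDiagram n) : Prop :=
  R1Ins G G' ∨ R1Ins G' G

/-- Insertion of a parallel pair `g₊, g₋` of arrows of opposite signs, with
heads consecutive on a common string and tails consecutive on a common string,
in parallel position (second Reidemeister move). -/
def R2Ins {n : ℕ} (G G' : GaussDiagram n) : Prop :=
  ∃ (ψ : G.Arrow → G'.Arrow) (gp gm : G'.Arrow),
    Function.Injective ψ ∧ ArrowMap G G' ψ ∧ OrderPresOn G G' ψ ∅ ∧
    gp ≠ gm ∧ (∀ g, ψ g ≠ gp ∧ ψ g ≠ gm) ∧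
    (∀ h, h ≠ gp → h ≠ gm → ∃ g, ψ g = h) ∧
    G'.sign gp = - G'.sign gm ∧ G'.hs gp = G'.hs gm ∧ G'.ts gp = G'.ts gm ∧
    Consecutive G' (gp, true) (gm, true) ∧
    Consecutive G' (gp, false) (gm, false) ∧
    (G'.hp gp < G'.hp gm ↔ G'.tp gp < G'.tp gm)

/-- Second Reidemeister move (insertion or deletion). -/
def R2Move {n : ℕ} (G G' : GaussDiagram n) : Prop :=
  R2Ins G G' ∨ R2Ins G' G

/-- Third Reidemeister move: the three designated pairs of consecutive
endpoints of the positive arrows `g ∼ (i₁,i₂)`, `h ∼ (i₁,i₃)`, `k ∼ (i₂,i₃)`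
have their relative order reversed, all other relative orders of endpoints
being preserved. -/
def R3Move {n : ℕ} (G G' : GaussDiagram n) : Prop :=
  ∃ (ψ : G.Arrow ≃ G'.Arrow) (g h k : G.Arrow),
    ArrowMap G G' ψ ∧
    g ≠ h ∧ g ≠ k ∧ h ≠ k ∧
    G.sign g = 1 ∧ G.sign h = 1 ∧ G.sign k = 1 ∧
    G.hs h = G.hs g ∧ G.hs k = G.ts g ∧ G.ts k = G.ts h ∧
    Consecutive G (g, true) (h, true) ∧
    Consecutive G (g, false) (k, true) ∧
    Consecutive G (h, false) (k, false) ∧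
    (G.epos (g, true) < G.epos (h, true) ↔
      G'.epos (ψ h, true) < G'.epos (ψ g, true)) ∧
    (G.epos (g, false) < G.epos (k, true) ↔
      G'.epos (ψ k, true) < G'.epos (ψ g, false)) ∧
    (G.epos (h, false) < G.epos (k, false) ↔
      G'.epos (ψ k, false) < G'.epos (ψ h, false)) ∧
    (∀ e e' : G.Arrow × Bool, G.estr e = G.estr e' →
      ¬ (({e, e'} : Set (G.Arrow × Bool)) = {(g, true), (h, true)} ∨
         ({e, e'} : Set (G.Arrow × Bool)) = {(g, false), (k, true)} ∨
         ({e, e'} : Set (G.Arrow × Bool)) = {(h, false), (k, false)}) →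
      (G.epos e < G.epos e' ↔ G'.epos (ψ e.1, e.2) < G'.epos (ψ e'.1, e'.2)))

/-- `G` and `G'` have identical sets of arrows with head and tail on distinct
strings (same signs, same head/tail strings, same relative order of the
endpoints of these arrows on each string); they may differ arbitrarily in
arrows whose head and tail lie on the same string.  This is the equivalence
generated by the self-arrow moves (insertion, deletion, sign change of an
arrow with both endpoints on one string). -/
def MixedEquiv {n : ℕ} (G G' : GaussDiagram n) : Prop :=
  ∃ ψ : {g : G.Arrow // G.hs g ≠ G.ts g} ≃ {g : G'.Arrow // G'.hs g ≠ G'.ts g},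
    (∀ g, G'.sign (ψ g).1 = G.sign g.1) ∧
    (∀ g, G'.hs (ψ g).1 = G.hs g.1) ∧
    (∀ g, G'.ts (ψ g).1 = G.ts g.1) ∧
    (∀ (g g' : {g : G.Arrow // G.hs g ≠ G.ts g}) (b b' : Bool),
      G.estr (g.1, b) = G.estr (g'.1, b') →
      (G.epos (g.1, b) < G.epos (g'.1, b') ↔
        G'.epos ((ψ g).1, b) < G'.epos ((ψ g').1, b')))

/-- A single arrow `g` of `G` is replaced by the arrow `g' = ψ g` of `G'` with
the same sign, head string and tail string, in a possibly different position;
all other arrows and all relative orders of their endpoints are unchanged. -/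
def MovedArrow {n : ℕ} (G G' : GaussDiagram n) (g : G.Arrow) (g' : G'.Arrow) :
    Prop :=
  ∃ ψ : G.Arrow ≃ G'.Arrow, ψ g = g' ∧ ArrowMap G G' ψ ∧
    ∀ e e' : G.Arrow × Bool, e.1 ≠ g → e'.1 ≠ g → G.estr e = G.estr e' →
      (G.epos e < G.epos e' ↔ G'.epos (ψ e.1, e.2) < G'.epos (ψ e'.1, e'.2))
/-! ### Stacking of planar tree diagrams -/

/-- Relabelling of the strings of `P` (a planar tree diagram on the strings
`1,…,n` with trunk `r`) when a diagram on `m` strings with trunk `s` is stacked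
onto its `k`-th leaf: strings left of `k` keep their index, the `k`-th string
is glued onto the trunk of the stacked diagram (index `k+s-1`), and strings
right of `k` are shifted by `m-1`. -/
def embP (k m s p : ℕ) : ℕ :=
  if p < k then p else if p = k then k + s - 1 else p + m - 1

/-- The inverse relabelling: the string of `P` from which the string `i` of
`P ≺ₖ Q` originates. -/
def invP (k m s i : ℕ) : ℕ :=
  if i < k then i else if i = k + s - 1 then k else i - (m - 1)

/-- The number of arrowheads lying on the trunk string of the tree diagram `Q`
on `m` strings with trunk `s`. -/
def qcount (m s : ℕ) (Q : PreTree) : ℕ :=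
  ((((Finset.Icc 1 m).erase s)).filter fun q => Q.par q = s).card

/-- The stacking `P ≺ₖ Q` of the tree diagram `Q` (on `m` strings, trunk `s`)
onto the `k`-th leaf of the tree diagram `P`: the trunk string of `Q` is glued
onto the `k`-th leaf string of `P` (the arrows of `Q` lying above those of `P`
on the glued string) and the resulting strings are renumbered `1,…,n+m-1` in
left-to-right planar order, the strings of `Q` occupying positions
`k,…,k+m-1`. -/
def stack (k m s : ℕ) (P Q : PreTree) : PreTree where
  par i :=
    if k ≤ i ∧ i ≤ k + m - 1 ∧ i ≠ k + s - 1 then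
      k + Q.par (i - k + 1) - 1
    else
      embP k m s (P.par (invP k m s i))
  rk i :=
    if k ≤ i ∧ i ≤ k + m - 1 ∧ i ≠ k + s - 1 then
      Q.rk (i - k + 1)
    else if P.par (invP k m s i) = k ∧ invP k m s i ≠ k then
      P.rk (invP k m s i) + qcount m s Q
    else
      P.rk (invP k m s i)

/-- The trunk of `P ≺ₖ Q` (where `P` has trunk `r` and `Q` has `m` strings and
trunk `s`). -/
def stackTrunk (r k m s : ℕ) : ℕ :=
  if r < k then r else if k < r then r + m - 1 else k + s - 1

/-- The elementary tree `e ∈ 𝒜(2;1)`: one arrow with head on string `1` (the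
trunk) and tail on string `2`. -/
def etree : PreTree :=
  ⟨fun i => if i = 2 then 1 else i, fun _ => 0⟩

/-- The elementary tree `ē ∈ 𝒜(2;2)`: one arrow with head on string `2` (the
trunk) and tail on string `1`. -/
def ebar : PreTree :=
  ⟨fun i => if i = 1 then 2 else i, fun _ => 0⟩

/-- The `k`-th smallest element of the finite set `I` (`1`-indexed). -/
def enumIn (I : Finset ℕ) (k : ℕ) : ℕ :=
  (I.sort (· ≤ ·)).getD (k - 1) 0

/-- The (`1`-indexed) rank of `x` in the finite set `I`. -/
def rankIn (I : Finset ℕ) (x : ℕ) : ℕ :=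
  ((I.filter fun y => y ≤ x)).card

/-- Relabel a tree diagram on the strings `1,…,|I|` so that its strings are
indexed by the elements of `I` (in increasing order); this realizes a tree
diagram `A' ∈ 𝒜(I;·)` from `A ∈ 𝒜(|I|;·)` as in the pairing `⟨A, G(I)⟩`. -/
def relabel (I : Finset ℕ) (P : PreTree) : PreTree where
  par x := if x ∈ I then enumIn I (P.par (rankIn I x)) else x
  rk x := if x ∈ I then P.rk (rankIn I x) else 0

section Stacking

variable {n m r s k : ℕ} {P Q : PreTree}

/-- Strings of the stacked diagram `P ≺ₖ Q` away from its trunk come from `Q` or from `P`. -/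
theorem mem_stack_erase_iff (hr : 1 ≤ r ∧ r ≤ n) (hs : 1 ≤ s ∧ s ≤ m) (hk : 1 ≤ k ∧ k ≤ n)
    (i : ℕ) :
    i ∈ (Finset.Icc 1 (m + n - 1)).erase (stackTrunk r k m s) ↔
      (∃ q ∈ (Finset.Icc 1 m).erase s, k + q - 1 = i) ∨
        ∃ p ∈ (Finset.Icc 1 n).erase r, embP k m s p = i := by
  simp only [Finset.mem_erase, Finset.mem_Icc, stackTrunk]
  constructor
  · intro h
    by_cases hb : k ≤ i ∧ i ≤ k + m - 1 ∧ i ≠ k + s - 1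
    · exact Or.inl ⟨i - k + 1, by omega, by omega⟩
    · refine Or.inr ⟨invP k m s i, ?_, ?_⟩ <;> simp only [invP, embP] <;> split_ifs at * <;> omega
  · rintro (⟨q, hq, rfl⟩ | ⟨p, hp, rfl⟩)
    · split_ifs <;> omega
    · simp only [embP]
      split_ifs <;> omega

/-- Strings outside the leaf set, and the trunk, of `P ≺ₖ Q` come from such strings of `P`. -/
theorem exists_embP_of_notMem (hr : 1 ≤ r ∧ r ≤ n) (hs : 1 ≤ s ∧ s ≤ m) (hk : 1 ≤ k ∧ k ≤ n)
    {i : ℕ} (hi : i ∉ (Finset.Icc 1 (m + n - 1)).erase (stackTrunk r k m s)) :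
    ∃ p, p ∉ (Finset.Icc 1 n).erase r ∧ embP k m s p = i := by
  simp only [Finset.mem_erase, Finset.mem_Icc, stackTrunk] at hi ⊢
  refine ⟨invP k m s i, ?_, ?_⟩ <;> simp only [invP, embP] <;> split_ifs at * <;> omega

theorem invP_embP (hs : 1 ≤ s ∧ s ≤ m) (p : ℕ) : invP k m s (embP k m s p) = p := by
  simp only [invP, embP]
  split_ifs <;> omega

theorem embP_strictMono (hs : 1 ≤ s ∧ s ≤ m) : StrictMono (embP k m s) := by
  intro a b hab
  simp only [embP]
  split_ifs <;> omega

theorem embP_injective (hs : 1 ≤ s ∧ s ≤ m) : Function.Injective (embP k m s) :=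
  (embP_strictMono hs).injective

theorem embP_self : embP k m s k = k + s - 1 := by simp [embP]

theorem embP_notMem_block (hs : 1 ≤ s ∧ s ≤ m) (p : ℕ) :
    ¬(k ≤ embP k m s p ∧ embP k m s p ≤ k + m - 1 ∧ embP k m s p ≠ k + s - 1) := by
  simp only [embP]
  split_ifs <;> omega

theorem embQ_mem_block (hk : 1 ≤ k) {q : ℕ} (hq : q ∈ (Finset.Icc 1 m).erase s)
    (hs : 1 ≤ s) :
    k ≤ k + q - 1 ∧ k + q - 1 ≤ k + m - 1 ∧ k + q - 1 ≠ k + s - 1 := by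
  simp only [Finset.mem_erase, Finset.mem_Icc] at hq
  omega

theorem embP_ne_embQ (hk : 1 ≤ k) (hs : 1 ≤ s ∧ s ≤ m) {q : ℕ}
    (hq : q ∈ (Finset.Icc 1 m).erase s) (p : ℕ) : embP k m s p ≠ k + q - 1 := fun h =>
  embP_notMem_block hs p (h ▸ embQ_mem_block hk hq hs.1)

theorem embQ_sub {q : ℕ} (hq : q ∈ (Finset.Icc 1 m).erase s) :
    k + q - 1 - k + 1 = q := by
  simp only [Finset.mem_erase, Finset.mem_Icc] at hq
  omega

theorem stack_par_embQ (hk : 1 ≤ k) (hs : 1 ≤ s) {q : ℕ} (hq : q ∈ (Finset.Icc 1 m).erase s) :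
    (stack k m s P Q).par (k + q - 1) = k + Q.par q - 1 := by
  simp only [stack]
  rw [if_pos (embQ_mem_block hk hq hs), embQ_sub hq]

theorem stack_rk_embQ (hk : 1 ≤ k) (hs : 1 ≤ s) {q : ℕ} (hq : q ∈ (Finset.Icc 1 m).erase s) :
    (stack k m s P Q).rk (k + q - 1) = Q.rk q := by
  simp only [stack]
  rw [if_pos (embQ_mem_block hk hq hs), embQ_sub hq]

theorem stack_par_embP (hs : 1 ≤ s ∧ s ≤ m) (p : ℕ) :
    (stack k m s P Q).par (embP k m s p) = embP k m s (P.par p) := by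
  simp only [stack]
  rw [if_neg (embP_notMem_block hs p), invP_embP hs]

theorem stack_rk_embP (hs : 1 ≤ s ∧ s ≤ m) (p : ℕ) :
    (stack k m s P Q).rk (embP k m s p) =
      if P.par p = k ∧ p ≠ k then P.rk p + qcount m s Q else P.rk p := by
  simp only [stack]
  rw [if_neg (embP_notMem_block hs p), invP_embP hs]

theorem embQ_injOn (hk : 1 ≤ k) (t : Finset ℕ) (ht : t ⊆ (Finset.Icc 1 m).erase s) :
    Set.InjOn (fun q => k + q - 1) (t : Set ℕ) := by
  intro a ha b hb hab
  have ha := ht ha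
  have hb := ht hb
  simp only [Finset.mem_erase, Finset.mem_Icc] at ha hb hab
  omega

/-- On the glued string the arrowheads of `Q` lie above those of `P`. -/
theorem stack_rk_embQ_lt_rk_embP (hP : P.IsTreeDiagram (Finset.Icc 1 n) r)
    (hQ : Q.IsTreeDiagram (Finset.Icc 1 m) s) (hs : 1 ≤ s ∧ s ≤ m) (hk : 1 ≤ k) {q p : ℕ}
    (hq : q ∈ (Finset.Icc 1 m).erase s) (hp : p ∈ (Finset.Icc 1 n).erase r)
    (h : k + Q.par q - 1 = embP k m s (P.par p)) :
    (stack k m s P Q).rk (k + q - 1) < (stack k m s P Q).rk (embP k m s p) := by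
  obtain ⟨hQI, -, hQrk⟩ := hQ.1 q hq
  have hQs : Q.par q = s := by
    by_contra hne
    exact embP_ne_embQ hk hs (Finset.mem_erase.2 ⟨hne, hQI⟩) _ h.symm
  have hPk : P.par p = k := embP_injective hs (by rw [← h, hQs, embP_self])
  have hpk : p ≠ k := fun e => (hP.1 p hp).2.1 (hPk.trans e.symm)
  rw [stack_rk_embQ hk hs.1 hq, stack_rk_embP hs, if_pos ⟨hPk, hpk⟩]
  rw [hQs] at hQrk
  exact lt_of_lt_of_le hQrk (Nat.le_add_left _ _)

theorem stack_isTreeDiagram (hP : P.IsTreeDiagram (Finset.Icc 1 n) r)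
    (hQ : Q.IsTreeDiagram (Finset.Icc 1 m) s)
    (hr : 1 ≤ r ∧ r ≤ n) (hs : 1 ≤ s ∧ s ≤ m) (hk : 1 ≤ k ∧ k ≤ n) :
    (stack k m s P Q).IsTreeDiagram (Finset.Icc 1 (m + n - 1)) (stackTrunk r k m s) := by
  have cross := fun {q p} => stack_rk_embQ_lt_rk_embP hP hQ hs hk.1 (q := q) (p := p)
  obtain ⟨hP₁, hP₂, hP₃⟩ := hP
  obtain ⟨hQ₁, hQ₂, -⟩ := hQ
  have hmem := mem_stack_erase_iff hr hs hk
  have parQ := fun {q} => stack_par_embQ (P := P) (Q := Q) hk.1 hs.1 (m := m) (q := q)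
  have rkQ := fun {q} => stack_rk_embQ (P := P) (Q := Q) hk.1 hs.1 (m := m) (q := q)
  have parP := stack_par_embP (k := k) (P := P) (Q := Q) hs
  have rkP := stack_rk_embP (k := k) (P := P) (Q := Q) hs
  have imQ : ∀ c, (((Finset.Icc 1 m).erase s).filter fun b => Q.par b = c).image
      (fun q => k + q - 1) ⊆ ((Finset.Icc 1 (m + n - 1)).erase (stackTrunk r k m s)).filter
        fun b => (stack k m s P Q).par b = k + c - 1 := by
    intro c x hx
    obtain ⟨q, hq, rfl⟩ := Finset.mem_image.1 hx
    obtain ⟨hq', rfl⟩ := Finset.mem_filter.1 hq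
    exact Finset.mem_filter.2 ⟨(hmem _).2 (Or.inl ⟨q, hq', rfl⟩), parQ hq'⟩
  have imP : ∀ c, (((Finset.Icc 1 n).erase r).filter fun b => P.par b = c).image
      (embP k m s) ⊆ ((Finset.Icc 1 (m + n - 1)).erase (stackTrunk r k m s)).filter
        fun b => (stack k m s P Q).par b = embP k m s c := by
    intro c x hx
    obtain ⟨p, hp, rfl⟩ := Finset.mem_image.1 hx
    obtain ⟨hp', rfl⟩ := Finset.mem_filter.1 hp
    exact Finset.mem_filter.2 ⟨(hmem _).2 (Or.inr ⟨p, hp', rfl⟩), parP p⟩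
  have cardQ : ∀ c, ((((Finset.Icc 1 m).erase s).filter fun b => Q.par b = c).image
      (fun q => k + q - 1)).card = (((Finset.Icc 1 m).erase s).filter fun b => Q.par b = c).card :=
    fun c => Finset.card_image_of_injOn (embQ_injOn hk.1 _ (Finset.filter_subset _ _))
  have cardP : ∀ c, ((((Finset.Icc 1 n).erase r).filter fun b => P.par b = c).image
      (embP k m s)).card = (((Finset.Icc 1 n).erase r).filter fun b => P.par b = c).card :=
    fun c => Finset.card_image_of_injective _ (embP_injective hs)
  refine ⟨?_, ?_, ?_⟩
  · intro i hi
    rcases (hmem i).1 hi with ⟨q, hq, rfl⟩ | ⟨p, hp, rfl⟩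
    · obtain ⟨h₁, h₂, h₃⟩ := hQ₁ q hq
      rw [parQ hq, rkQ hq]
      refine ⟨?_, ?_, ?_⟩
      · simp only [Finset.mem_Icc] at h₁ ⊢
        omega
      · simp only [Finset.mem_erase, Finset.mem_Icc] at h₁ hq
        omega
      · exact h₃.trans_le ((cardQ _).ge.trans (Finset.card_le_card (imQ _)))
    · obtain ⟨h₁, h₂, h₃⟩ := hP₁ p hp
      rw [parP, rkP]
      refine ⟨?_, (embP_injective hs).ne h₂, ?_⟩
      · simp only [Finset.mem_Icc, embP] at h₁ ⊢
        split_ifs <;> omega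
      · split_ifs with hc
        · have hdisj : Disjoint
              ((((Finset.Icc 1 n).erase r).filter fun b => P.par b = k).image (embP k m s))
              ((((Finset.Icc 1 m).erase s).filter fun b => Q.par b = s).image
                fun q => k + q - 1) := by
            rw [Finset.disjoint_left]
            intro x hx hy
            obtain ⟨p', -, rfl⟩ := Finset.mem_image.1 hx
            obtain ⟨q', hq', h⟩ := Finset.mem_image.1 hy
            exact embP_ne_embQ hk.1 hs (Finset.mem_filter.1 hq').1 p' h.symm
          have hle := Finset.card_le_card
            (Finset.union_subset (imP k) (embP_self (k := k) (m := m) (s := s) ▸ imQ s))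
          rw [Finset.card_union_of_disjoint hdisj, cardP, cardQ] at hle
          rw [hc.1] at h₃ ⊢
          exact (Nat.add_lt_add_right h₃ _).trans_le hle
        · exact h₃.trans_le ((cardP _).ge.trans (Finset.card_le_card (imP _)))
  · intro i hi i' hi' hpar hrk
    rcases (hmem i).1 hi with ⟨q, hq, rfl⟩ | ⟨p, hp, rfl⟩ <;>
      rcases (hmem i').1 hi' with ⟨q', hq', rfl⟩ | ⟨p', hp', rfl⟩
    · rw [parQ hq, parQ hq'] at hpar
      rw [rkQ hq, rkQ hq'] at hrk
      have h₁ := (hQ₁ q hq).1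
      have h₂ := (hQ₁ q' hq').1
      simp only [Finset.mem_Icc] at h₁ h₂
      rw [hQ₂ q hq q' hq' (by omega) hrk]
    · rw [parQ hq, parP] at hpar
      exact absurd hrk (cross hq hp' hpar).ne
    · rw [parP, parQ hq'] at hpar
      exact absurd hrk (cross hq' hp hpar.symm).ne'
    · rw [parP, parP] at hpar
      have hpp := embP_injective hs hpar
      have h₁ := (hP₁ p hp).2.1
      have h₂ := (hP₁ p' hp').2.1
      rw [rkP, rkP] at hrk
      rw [hP₂ p hp p' hp' hpp (by split_ifs at hrk <;> omega)]
  · intro i hi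
    obtain ⟨p, hp, rfl⟩ := exists_embP_of_notMem hr hs hk hi
    obtain ⟨h₁, h₂⟩ := hP₃ p hp
    rw [parP, rkP, h₁, h₂]
    exact ⟨rfl, if_neg fun h => h.2 h.1⟩

/-- Height functions on finite sets can be separated by a translation. -/
theorem exists_sub_lt (I J : Finset ℕ) (f g : ℕ → ℚ) :
    ∃ C : ℚ, ∀ i ∈ I, ∀ j ∈ J, f i - C < g j := by
  obtain ⟨a, ha⟩ := (I.image f).bddAbove
  obtain ⟨b, hb⟩ := (J.image g).bddBelow
  refine ⟨a - b + 1, fun i hi j hj => ?_⟩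
  have h₁ : f i ≤ a := ha (Finset.mem_coe.2 (Finset.mem_image_of_mem f hi))
  have h₂ : b ≤ g j := hb (Finset.mem_coe.2 (Finset.mem_image_of_mem g hj))
  linarith

theorem stack_isPlanar (hP : P ∈ TreeSetFull n r) (hQ : Q ∈ TreeSetFull m s)
    (hr : 1 ≤ r ∧ r ≤ n) (hs : 1 ≤ s ∧ s ≤ m) (hk : 1 ≤ k ∧ k ≤ n) :
    (stack k m s P Q).IsPlanar (Finset.Icc 1 (m + n - 1)) (stackTrunk r k m s) := by
  have rkcross := fun {q p} => stack_rk_embQ_lt_rk_embP hP.1 hQ.1 hs hk.1 (q := q) (p := p)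
  obtain ⟨⟨hP₁, -, -⟩, f, hf₁, hf₂, hf₃, hf₄⟩ := hP
  obtain ⟨⟨hQ₁, -, -⟩, g, hg₁, hg₂, hg₃, hg₄⟩ := hQ
  obtain ⟨C, hC⟩ := exists_sub_lt ((Finset.Icc 1 m).erase s) ((Finset.Icc 1 n).erase r) g f
  have hmem := mem_stack_erase_iff hr hs hk
  have parQ := fun {q} => stack_par_embQ (P := P) (Q := Q) hk.1 hs.1 (m := m) (q := q)
  have rkQ := fun {q} => stack_rk_embQ (P := P) (Q := Q) hk.1 hs.1 (m := m) (q := q)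
  have parP := stack_par_embP (k := k) (P := P) (Q := Q) hs
  have rkP := stack_rk_embP (k := k) (P := P) (Q := Q) hs
  let h : ℕ → ℚ := fun i =>
    if k ≤ i ∧ i ≤ k + m - 1 ∧ i ≠ k + s - 1 then g (i - k + 1) - C else f (invP k m s i)
  have hhQ : ∀ q ∈ (Finset.Icc 1 m).erase s, h (k + q - 1) = g q - C := fun q hq => by
    simp only [h]
    rw [if_pos (embQ_mem_block hk.1 hq hs.1), embQ_sub hq]
  have hhP : ∀ p, h (embP k m s p) = f p := fun p => by
    simp only [h]
    rw [if_neg (embP_notMem_block hs p), invP_embP hs]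
  have cross : ∀ q ∈ (Finset.Icc 1 m).erase s, ∀ p ∈ (Finset.Icc 1 n).erase r,
      h (k + q - 1) < h (embP k m s p) := fun q hq p hp => by
    rw [hhQ q hq, hhP]
    exact hC q hq p hp
  have parQ_pos : ∀ q ∈ (Finset.Icc 1 m).erase s, 1 ≤ Q.par q ∧ Q.par q ≤ m := fun q hq =>
    Finset.mem_Icc.1 (hQ₁ q hq).1
  refine ⟨h, ?_, ?_, ?_, ?_⟩
  · intro i hi i' hi' hh
    rcases (hmem i).1 hi with ⟨q, hq, rfl⟩ | ⟨p, hp, rfl⟩ <;>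
      rcases (hmem i').1 hi' with ⟨q', hq', rfl⟩ | ⟨p', hp', rfl⟩
    · rw [hhQ q hq, hhQ q' hq', sub_left_inj] at hh
      rw [hg₁ q hq q' hq' hh]
    · exact absurd hh (cross q hq p' hp').ne
    · exact absurd hh (cross q' hq' p hp).ne'
    · rw [hhP, hhP] at hh
      rw [hf₁ p hp p' hp' hh]
  · intro i hi i' hi' hpar
    rcases (hmem i).1 hi with ⟨q, hq, rfl⟩ | ⟨p, hp, rfl⟩ <;>
      rcases (hmem i').1 hi' with ⟨q', hq', rfl⟩ | ⟨p', hp', rfl⟩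
    · rw [parQ hq, parQ hq'] at hpar
      rw [rkQ hq, rkQ hq', hhQ q hq, hhQ q' hq', sub_lt_sub_iff_right]
      have h₁ := parQ_pos q hq
      have h₂ := parQ_pos q' hq'
      exact hg₂ q hq q' hq' (by omega)
    · rw [parQ hq, parP] at hpar
      exact iff_of_true (rkcross hq hp' hpar) (cross q hq p' hp')
    · rw [parP, parQ hq'] at hpar
      exact iff_of_false (rkcross hq' hp hpar.symm).not_gt (cross q' hq' p hp).not_gt
    · rw [parP, parP] at hpar
      have hpp := embP_injective hs hpar
      have h₁ := (hP₁ p hp).2.1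
      have h₂ := (hP₁ p' hp').2.1
      rw [hhP, hhP, ← hf₂ p hp p' hp' hpp, rkP, rkP]
      split_ifs <;> omega
  · intro i hi i' hi' hpar
    rcases (hmem i).1 hi with ⟨q, hq, rfl⟩ | ⟨p, hp, rfl⟩ <;>
      rcases (hmem i').1 hi' with ⟨q', hq', rfl⟩ | ⟨p', hp', rfl⟩
    · rw [parQ hq] at hpar
      rw [hhQ q hq, hhQ q' hq', sub_lt_sub_iff_right]
      have h₁ := parQ_pos q hq
      have h₂ := Finset.mem_Icc.1 (Finset.mem_of_mem_erase hq')
      exact hg₃ q hq q' hq' (by omega)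
    · exact cross q hq p' hp'
    · rw [parP] at hpar
      exact absurd hpar (embP_ne_embQ hk.1 hs hq' _)
    · rw [parP] at hpar
      rw [hhP, hhP]
      exact hf₃ p hp p' hp' (embP_injective hs hpar)
  · intro a ha l hl hlo hhi
    have ht : stackTrunk r k m s = embP k m s r := by
      simp only [stackTrunk, embP]
      split_ifs <;> omega
    have hl' : (∃ q ∈ (Finset.Icc 1 m).erase s, k + q - 1 = l) ∨
        ∃ p ∈ Finset.Icc 1 n, embP k m s p = l := by
      by_cases e : l = stackTrunk r k m s
      · exact Or.inr ⟨r, Finset.mem_Icc.2 hr, by rw [e, ht]⟩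
      · refine ((hmem l).1 (Finset.mem_erase.2 ⟨e, hl⟩)).imp_right ?_
        rintro ⟨p, hp, rfl⟩
        exact ⟨p, Finset.mem_of_mem_erase hp, rfl⟩
    rcases (hmem a).1 ha with ⟨q, hq, rfl⟩ | ⟨p, hp, rfl⟩ <;>
      rcases hl' with ⟨q', hq', rfl⟩ | ⟨p', hp', rfl⟩
    · rw [parQ hq] at hlo hhi
      have h₁ := parQ_pos q hq
      have h₂ := Finset.mem_Icc.1 (Finset.mem_of_mem_erase hq)
      have h₃ := Finset.mem_of_mem_erase hq'
      have h₄ := Finset.mem_Icc.1 h₃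
      refine ⟨ht ▸ (embP_ne_embQ hk.1 hs hq' r).symm, ?_⟩
      rw [hhQ q hq, hhQ q' hq', sub_lt_sub_iff_right]
      exact (hg₄ q hq q' h₃ (by omega) (by omega)).2
    · rw [parQ hq] at hlo hhi
      have h₁ := parQ_pos q hq
      have h₂ := Finset.mem_Icc.1 (Finset.mem_of_mem_erase hq)
      have h₃ := embP_notMem_block (k := k) hs p'
      exact absurd rfl (hg₄ q hq s (Finset.mem_Icc.2 hs) (by omega) (by omega)).1
    · exact ⟨ht ▸ (embP_ne_embQ hk.1 hs hq' r).symm, cross q' hq' p hp⟩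
    · have hmono := embP_strictMono (k := k) hs
      rw [parP, ← hmono.monotone.map_min, hmono.lt_iff_lt] at hlo
      rw [parP, ← hmono.monotone.map_max, hmono.lt_iff_lt] at hhi
      rw [ht, hmono.injective.ne_iff, hhP, hhP]
      exact hf₄ p hp p' hp' hlo hhi

end Stacking

/-- **Well-definedness of tree stacking and the trunk index formula.**
For `P ∈ 𝒜(n;r)`, `Q ∈ 𝒜(m;s)` and `k ∈ {1,…,n}`, the stacked diagram
`P ≺ₖ Q` is a planar tree diagram in `𝒜(m+n-1;t)`, where `t = r` if `r < k`,
`t = r + m - 1` if `r > k`, and `t = r + s - 1` if `r = k`. -/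
theorem stack_mem (n m r s k : ℕ) (P Q : PreTree)
    (hP : P ∈ TreeSetFull n r) (hQ : Q ∈ TreeSetFull m s)
    (hr : 1 ≤ r ∧ r ≤ n) (hs : 1 ≤ s ∧ s ≤ m) (hk : 1 ≤ k ∧ k ≤ n) :
    stack k m s P Q ∈ TreeSetFull (m + n - 1) (stackTrunk r k m s) := by
  exact ⟨stack_isTreeDiagram hP.1 hQ.1 hr hs hk, stack_isPlanar hP hQ hr hs hk⟩
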